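/- In ℂ[y,z] graded by wt y = 1, wt z = 2, let 𝒜 be the subalgebra generated by g_2 = y²−2kz, g_3 = y³−3kyz, g_4 = z², g_5 = yz² (k ≥ 5 an integer) and J = ℂ[y,z]f_0 + ℂ[y,z]f_1 the ideal generated by f_0 and f_1 = D f_0 as above. Then dim 𝒜/(J ∩ 𝒜) = k(k+1)/2; explicitly, (J ∩ 𝒜)_{(n)} = 0 for n ≤ k, (J ∩ 𝒜)_{(k+1)} = ℂf_0, dim (J ∩ 𝒜)_{(n)} = n−k−1 for k+2 ≤ n ≤ 2k+2, and (J ∩ 𝒜)_{(n)} = 𝒜_{(n)} for n ≥ 2k+1. -/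

import Mathlib

open MvPolynomial

noncomputable def g2 (k : ℂ) : MvPolynomial (Fin 2) ℂ := X 0 ^ 2 - C (2 * k) * X 1
noncomputable def g3 (k : ℂ) : MvPolynomial (Fin 2) ℂ := X 0 ^ 3 - C (3 * k) * X 0 * X 1
noncomputable def g4 : MvPolynomial (Fin 2) ℂ := X 1 ^ 2
noncomputable def g5 : MvPolynomial (Fin 2) ℂ := X 0 * X 1 ^ 2

/-- The subalgebra `𝒜` generated by `g₂, g₃, g₄, g₅`, as a `ℂ`-submodule. -/
noncomputable def calA (k : ℂ) : Submodule ℂ (MvPolynomial (Fin 2) ℂ) :=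
  Subalgebra.toSubmodule (Algebra.adjoin ℂ {g2 k, g3 k, g4, g5})

/-- The operator `D = ((k+2)y² − 2kz) ∂/∂y + (3k+4) yz ∂/∂z` on `ℂ[y,z]`. -/
noncomputable def D2 (k : ℂ) : MvPolynomial (Fin 2) ℂ → MvPolynomial (Fin 2) ℂ :=
  fun p => (C (k + 2) * X 0 ^ 2 - C (2 * k) * X 1) * pderiv 0 p
    + C (3 * k + 4) * X 0 * X 1 * pderiv 1 p

/-- `f₀(y,z) = Σⱼ (−1)ʲ (k+1)!/((k+1−2j)!(j!)²) y^{k+1−2j} zʲ`. -/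
noncomputable def f0 (k : ℕ) : MvPolynomial (Fin 2) ℂ :=
  ∑ j ∈ Finset.range ((k + 1) / 2 + 1),
    C ((-1) ^ j * (Nat.factorial (k + 1) : ℂ) /
      (Nat.factorial (k + 1 - 2 * j) * (Nat.factorial j) ^ 2)) *
    X 0 ^ (k + 1 - 2 * j) * X 1 ^ j

/-- The ideal `J = (f₀, f₁)` of `ℂ[y,z]`, where `f₁ = D f₀`. -/
noncomputable def Jideal (k : ℕ) : Ideal (MvPolynomial (Fin 2) ℂ) :=
  Ideal.span {f0 k, D2 (k : ℂ) (f0 k)}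

/-- The weight-`n` component of `ℂ[y,z]` for the grading `wt y = 1`, `wt z = 2`. -/
noncomputable def Wt (n : ℕ) : Submodule ℂ (MvPolynomial (Fin 2) ℂ) :=
  weightedHomogeneousSubmodule ℂ (![1, 2] : Fin 2 → ℕ) n

/-- `J ∩ 𝒜`, as a `ℂ`-submodule of `ℂ[y,z]`. -/
noncomputable def JA (k : ℕ) : Submodule ℂ (MvPolynomial (Fin 2) ℂ) :=
  Submodule.restrictScalars ℂ (Jideal k) ⊓ calA (k : ℂ)

/-- The coefficient of `y ^ (n - 2 * j) * z ^ j` in `f₀`, for `n = k + 1`. -/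
noncomputable def f0Coeff (n j : ℕ) : ℂ := (-1) ^ j * n.choose (2 * j) * j.centralBinom

lemma f0Coeff_zero (n : ℕ) : f0Coeff n 0 = 1 := by simp [f0Coeff]

lemma f0Coeff_succ (n j : ℕ) :
    ((j : ℂ) + 1) ^ 2 * f0Coeff n (j + 1) =
      -(((n - 2 * j : ℕ) : ℂ) * ((n - 2 * j - 1 : ℕ) : ℂ) * f0Coeff n j) := by
  have h1 : (n.choose (2 * j + 1) : ℂ) * (2 * j + 1) = n.choose (2 * j) * (n - 2 * j : ℕ) := by
    exact_mod_cast Nat.choose_succ_right_eq n (2 * j)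
  have h2 : (n.choose (2 * (j + 1)) : ℂ) * (2 * j + 1 + 1) =
      n.choose (2 * j + 1) * (n - 2 * j - 1 : ℕ) := by
    exact_mod_cast Nat.choose_succ_right_eq n (2 * j + 1)
  have h3 : ((j : ℂ) + 1) * (j + 1).centralBinom = 2 * (2 * j + 1) * j.centralBinom := by
    exact_mod_cast Nat.succ_mul_centralBinom_succ j
  simp only [f0Coeff]
  linear_combination (-1 : ℂ) ^ (j + 1) * ((j + 1) * n.choose (2 * (j + 1)) * h3
    + (2 * j + 1) * j.centralBinom * h2 + (n - 2 * j - 1 : ℕ) * j.centralBinom * h1)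

lemma f0_eq (k : ℕ) : f0 k = ∑ j ∈ Finset.range ((k + 1) / 2 + 1),
    C (f0Coeff (k + 1) j) * X 0 ^ (k + 1 - 2 * j) * X 1 ^ j := by
  refine Finset.sum_congr rfl fun j hj => ?_
  have hj : 2 * j ≤ k + 1 := by have := Finset.mem_range.1 hj; omega
  congr 3
  have h1 : ((k + 1).choose (2 * j) : ℂ) * (2 * j).factorial * (k + 1 - 2 * j).factorial
      = (k + 1).factorial := by exact_mod_cast Nat.choose_mul_factorial_mul_factorial hj
  have h2 : (j.centralBinom : ℂ) * j.factorial * j.factorial = (2 * j).factorial := by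
    have := Nat.choose_mul_factorial_mul_factorial (n := 2 * j) (k := j) (by omega)
    rw [show 2 * j - j = j by omega] at this
    exact_mod_cast this
  have h3 : ((k + 1 - 2 * j).factorial : ℂ) ≠ 0 := by exact_mod_cast Nat.factorial_ne_zero _
  have h4 : (j.factorial : ℂ) ≠ 0 := by exact_mod_cast Nat.factorial_ne_zero _
  rw [f0Coeff, div_eq_iff (by positivity), ← h1, ← h2]
  ring

lemma pderiv_zero_C_mul_pow (c : ℂ) (a j : ℕ) :
    pderiv 0 (C c * X 0 ^ a * X 1 ^ j : MvPolynomial (Fin 2) ℂ) =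
      C (c * a) * X 0 ^ (a - 1) * X 1 ^ j := by
  simp [pderiv_X]
  ring

lemma pderiv_zero_iterate_C_mul_pow (m : ℕ) (c : ℂ) (a j : ℕ) :
    (pderiv 0)^[m] (C c * X 0 ^ a * X 1 ^ j : MvPolynomial (Fin 2) ℂ) =
      C (c * a.descFactorial m) * X 0 ^ (a - m) * X 1 ^ j := by
  induction m with
  | zero => simp
  | succ m ih =>
    rw [Function.iterate_succ_apply', ih, pderiv_zero_C_mul_pow, Nat.descFactorial_succ,
      Nat.sub_sub]
    push_cast
    ring_nf

lemma pderiv_iterate_f0 (k : ℕ) :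
    (pderiv 0)^[k + 1] (f0 k) = C ((k + 1).factorial : ℂ) := by
  have h : ∀ p : MvPolynomial (Fin 2) ℂ,
      (pderiv (R := ℂ) (0 : Fin 2))^[k + 1] p =
        ((pderiv (R := ℂ) (0 : Fin 2)).toLinearMap ^ (k + 1)) p := by
    intro p
    rw [Module.End.pow_apply]
    rfl
  rw [h, f0_eq, map_sum, Finset.sum_eq_single 0]
  · rw [← h, pderiv_zero_iterate_C_mul_pow]
    rw [Nat.mul_zero, Nat.sub_zero, Nat.descFactorial_self, f0Coeff_zero]
    simp
  · intro j hj hj0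
    have := Finset.mem_range.1 hj
    rw [← h, pderiv_zero_iterate_C_mul_pow, Nat.descFactorial_of_lt (by omega)]
    simp
  · simp

/-- The differential equation of Legendre type satisfied by `f₀`. -/
lemma f0_ode (k : ℕ) :
    (X 0 ^ 2 + 4 * X 1) * pderiv 0 (pderiv 0 (f0 k)) +
      C (1 - 2 * ((k : ℂ) + 1)) * X 0 * pderiv 0 (f0 k) + C (((k : ℂ) + 1) ^ 2) * f0 k = 0 := by
  set T : ℕ → MvPolynomial (Fin 2) ℂ := fun j =>
    C (4 * (j : ℂ) ^ 2 * f0Coeff (k + 1) j) * X 0 ^ (k + 1 - 2 * j) * X 1 ^ j with hT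
  have key : ∀ j ∈ Finset.range ((k + 1) / 2 + 1),
      (X 0 ^ 2 + 4 * X 1) * pderiv 0 (pderiv 0
          (C (f0Coeff (k + 1) j) * X 0 ^ (k + 1 - 2 * j) * X 1 ^ j)) +
      C (1 - 2 * ((k : ℂ) + 1)) * X 0 * pderiv 0
          (C (f0Coeff (k + 1) j) * X 0 ^ (k + 1 - 2 * j) * X 1 ^ j) +
      C (((k : ℂ) + 1) ^ 2) * (C (f0Coeff (k + 1) j) * X 0 ^ (k + 1 - 2 * j) * X 1 ^ j)
      = T j - T (j + 1) := by
    intro j hj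
    have hs : ((k + 1 - 2 * j : ℕ) : ℂ) = k + 1 - 2 * j := by
      have := Finset.mem_range.1 hj
      rw [Nat.cast_sub (by omega)]
      push_cast
      ring
    have hrec := congrArg (C (σ := Fin 2)) (f0Coeff_succ (k + 1) j)
    have hs' := congrArg (C (σ := Fin 2)) hs
    simp only [hT, pderiv_zero_C_mul_pow]
    rw [show k + 1 - 2 * (j + 1) = k + 1 - 2 * j - 1 - 1 by omega]
    generalize k + 1 - 2 * j = s at *
    generalize f0Coeff (k + 1) j = a at *
    generalize f0Coeff (k + 1) (j + 1) = b at *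
    have hC4 : C (σ := Fin 2) (4 : ℂ) = 4 := map_ofNat C 4
    have hC2 : C (σ := Fin 2) (2 : ℂ) = 2 := map_ofNat C 2
    simp only [map_mul, map_add, map_sub, map_pow, map_neg, map_one, hC4, hC2, Nat.cast_add,
      Nat.cast_one] at hrec hs' ⊢
    rcases s with _ | _ | t
    · simp only [Nat.cast_zero, map_zero, zero_tsub] at hrec hs' ⊢
      linear_combination X 1 ^ j * C a * (-C (k : ℂ) - 1 - 2 * C (j : ℂ)) * hs' +
        4 * X 1 ^ (j + 1) * hrec
    · simp only [Nat.cast_zero, Nat.cast_one, map_one, map_zero, zero_add,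
        Nat.sub_self] at hrec hs' ⊢
      linear_combination X 0 * X 1 ^ j * C a * (-C (k : ℂ) - 2 * C (j : ℂ)) * hs' +
        4 * X 1 ^ (j + 1) * hrec
    · simp only [Nat.add_sub_cancel, Nat.cast_add, Nat.cast_one, map_add, map_one] at hrec hs' ⊢
      linear_combination X 0 ^ (t + 2) * X 1 ^ j * C a *
        (C (t : ℂ) + 1 - C (k : ℂ) - 2 * C (j : ℂ)) * hs' +
        4 * X 1 ^ (j + 1) * X 0 ^ t * hrec
  rw [f0_eq]
  simp only [map_sum, Finset.mul_sum]
  rw [← Finset.sum_add_distrib, ← Finset.sum_add_distrib, Finset.sum_congr rfl key,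
    Finset.sum_range_sub']
  have h0 : f0Coeff (k + 1) ((k + 1) / 2 + 1) = 0 := by
    rw [f0Coeff, Nat.choose_eq_zero_of_lt (by omega)]
    simp
  simp [hT, h0]

lemma X_zero_mem_Wt : (X 0 : MvPolynomial (Fin 2) ℂ) ∈ Wt 1 :=
  isWeightedHomogeneous_X ℂ ![1, 2] 0

lemma X_one_mem_Wt : (X 1 : MvPolynomial (Fin 2) ℂ) ∈ Wt 2 :=
  isWeightedHomogeneous_X ℂ ![1, 2] 1

lemma C_mem_Wt (c : ℂ) : (C c : MvPolynomial (Fin 2) ℂ) ∈ Wt 0 :=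
  isWeightedHomogeneous_C ![1, 2] c

lemma mul_mem_Wt {p q : MvPolynomial (Fin 2) ℂ} {m n l : ℕ} (hp : p ∈ Wt m) (hq : q ∈ Wt n)
    (h : m + n = l) : p * q ∈ Wt l :=
  h ▸ IsWeightedHomogeneous.mul hp hq

lemma C_mul_pow_mem_Wt (c : ℂ) {a b n : ℕ} (h : a + 2 * b = n) :
    (C c * X 0 ^ a * X 1 ^ b : MvPolynomial (Fin 2) ℂ) ∈ Wt n := by
  refine mul_mem_Wt (mul_mem_Wt (C_mem_Wt c) (IsWeightedHomogeneous.pow X_zero_mem_Wt a) rfl)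
    (IsWeightedHomogeneous.pow X_one_mem_Wt b) ?_
  simp only [smul_eq_mul]
  omega

lemma f0_mem_Wt (k : ℕ) : f0 k ∈ Wt (k + 1) := by
  rw [f0_eq]
  refine Submodule.sum_mem _ fun j hj => C_mul_pow_mem_Wt _ ?_
  have := Finset.mem_range.1 hj
  omega

lemma pderiv_zero_mem_Wt {p : MvPolynomial (Fin 2) ℂ} {n : ℕ} (h : p ∈ Wt (n + 1)) :
    pderiv 0 p ∈ Wt n :=
  IsWeightedHomogeneous.pderiv h rfl

/-- Modulo `f₀`, the polynomial `f₁` is a multiple of `(y² + 4z) ∂f₀/∂y`. -/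
lemma two_mul_D2_f0 (k : ℕ) : 2 * D2 k (f0 k) =
    C ((3 * k + 4) * (k + 1) : ℂ) * X 0 * f0 k
      - C (k : ℂ) * ((X 0 ^ 2 + 4 * X 1) * pderiv 0 (f0 k)) := by
  have h := IsWeightedHomogeneous.sum_weight_X_mul_pderiv (f0_mem_Wt k)
  simp only [Fin.sum_univ_two, Matrix.cons_val_zero, Matrix.cons_val_one, nsmul_eq_mul,
    Nat.cast_one, one_mul, Nat.cast_ofNat, Nat.cast_add] at h
  have hk : C (σ := Fin 2) (k : ℂ) = (k : MvPolynomial (Fin 2) ℂ) := map_natCast C k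
  have hC4 : C (σ := Fin 2) (4 : ℂ) = 4 := map_ofNat C 4
  have hC3 : C (σ := Fin 2) (3 : ℂ) = 3 := map_ofNat C 3
  have hC2 : C (σ := Fin 2) (2 : ℂ) = 2 := map_ofNat C 2
  simp only [D2, map_mul, map_add, map_one, hk, hC2, hC3, hC4]
  linear_combination (3 * (k : MvPolynomial (Fin 2) ℂ) + 4) * X 0 * h

lemma D2_f0_mem_Wt (k : ℕ) : D2 k (f0 k) ∈ Wt (k + 2) := by
  have h1 : 2 * D2 k (f0 k) ∈ Wt (k + 2) := by
    rw [two_mul_D2_f0]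
    refine Submodule.sub_mem _ (mul_mem_Wt (mul_mem_Wt (C_mem_Wt _) X_zero_mem_Wt rfl)
      (f0_mem_Wt k) (by omega)) (mul_mem_Wt (C_mem_Wt _) (mul_mem_Wt (m := 2) ?_
      (pderiv_zero_mem_Wt (f0_mem_Wt k)) rfl) (by omega))
    have h4 : (4 : MvPolynomial (Fin 2) ℂ) ∈ Wt 0 := by
      rw [← map_ofNat C 4]
      exact C_mem_Wt 4
    exact Submodule.add_mem _ (IsWeightedHomogeneous.pow X_zero_mem_Wt 2)
      (mul_mem_Wt h4 X_one_mem_Wt rfl)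
  have h2 : D2 k (f0 k) = (2⁻¹ : ℂ) • (2 * D2 k (f0 k)) := by
    rw [two_mul, ← two_smul ℂ, smul_smul]
    norm_num
  rw [h2]
  exact Submodule.smul_mem _ _ h1

lemma f0_ne_zero (k : ℕ) : f0 k ≠ 0 := by
  intro h
  have h1 := pderiv_iterate_f0 k
  rw [h, Function.iterate_fixed (map_zero _), eq_comm, C_eq_zero] at h1
  exact Nat.factorial_ne_zero _ (by exact_mod_cast h1)

/-- The `m`-th derivative of the equation `f0_ode`. -/
lemma f0_ode_iterate (k m : ℕ) :
    (X 0 ^ 2 + 4 * X 1) * (pderiv 0)^[m + 2] (f0 k) +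
      C (2 * m + 1 - 2 * ((k : ℂ) + 1)) * X 0 * (pderiv 0)^[m + 1] (f0 k) +
      C (((k : ℂ) + 1 - m) ^ 2) * (pderiv 0)^[m] (f0 k) = 0 := by
  induction m with
  | zero => simpa using f0_ode k
  | succ m ih =>
    have h := congrArg (pderiv 0) ih
    have h4 : pderiv (0 : Fin 2) (4 : MvPolynomial (Fin 2) ℂ) = 0 := by
      rw [← map_ofNat C 4, pderiv_C]
    simp only [map_add, map_zero, Derivation.leibniz, smul_eq_mul, pderiv_C, h4, pderiv_X_self,
      pderiv_X_of_ne (show (1 : Fin 2) ≠ 0 by decide), Derivation.leibniz_pow,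
      ← Function.iterate_succ_apply'] at h
    have hC2 : C (σ := Fin 2) (2 : ℂ) = 2 := map_ofNat C 2
    simp only [map_mul, map_add, map_sub, map_pow, map_one, hC2, Nat.cast_add, Nat.cast_one] at h ⊢
    linear_combination h

lemma isRelPrime_f0_D2_f0 {k : ℕ} (hk : 0 < k) : IsRelPrime (f0 k) (D2 k (f0 k)) := by
  rw [UniqueFactorizationMonoid.isRelPrime_iff_no_prime_factors (f0_ne_zero k)]
  intro p hp0 hp1 hp
  have hC : ∀ {c : ℂ}, c ≠ 0 → ¬ p ∣ C c := fun hc h =>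
    hp.not_isUnit (isUnit_of_dvd_unit h ((isUnit_iff_ne_zero.2 hc).map C))
  have hwd : p ∣ (X 0 ^ 2 + 4 * X 1) * pderiv 0 (f0 k) := by
    have h : p ∣ C (k : ℂ) * ((X 0 ^ 2 + 4 * X 1) * pderiv 0 (f0 k)) := by
      have h1 := dvd_sub (hp0.mul_left (C ((3 * k + 4) * (k + 1) : ℂ) * X 0)) (hp1.mul_left 2)
      rwa [two_mul_D2_f0, sub_sub_cancel] at h1
    exact (hp.dvd_or_dvd h).resolve_left (hC (by exact_mod_cast hk.ne'))
  have hfact : ¬ p ∣ (pderiv 0)^[k + 1] (f0 k) := by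
    rw [pderiv_iterate_f0]
    exact hC (by exact_mod_cast Nat.factorial_ne_zero _)
  by_cases hw : p ∣ X 0 ^ 2 + 4 * X 1
  · have hX : ¬ p ∣ X 0 := by
      intro h0
      have h1 : p ∣ C 4 * X 1 := by
        rw [map_ofNat C 4]
        exact (dvd_add_right (h0.trans (dvd_pow_self _ two_ne_zero))).1 hw
      have h2 := (hp.dvd_or_dvd h1).resolve_left (hC (c := 4) (by norm_num))
      have h3 := (hp.associated_of_dvd X_prime h0).symm.dvd.trans h2
      exact absurd (X_dvd_X.1 h3) (by decide)
    refine hfact ?_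
    have hall : ∀ m, p ∣ (pderiv 0)^[m] (f0 k) := by
      intro m
      induction m with
      | zero => exact hp0
      | succ m ih =>
        have h := f0_ode_iterate k m
        have h1 : p ∣ C (2 * m + 1 - 2 * ((k : ℂ) + 1)) * X 0 * (pderiv 0)^[m + 1] (f0 k) := by
          rw [← dvd_add_right (hw.mul_right ((pderiv 0)^[m + 2] (f0 k))),
            ← dvd_add_left (ih.mul_left (C (((k : ℂ) + 1 - m) ^ 2))), h]
          exact dvd_zero p
        refine (hp.dvd_or_dvd h1).resolve_left fun h2 => ?_
        refine (hp.dvd_or_dvd h2).elim (hC fun h3 => ?_) hX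
        have h4 : (2 * m + 1 : ℂ) = (2 * (k + 1) : ℕ) := by
          push_cast
          linear_combination h3
        have h5 : 2 * m + 1 = 2 * (k + 1) := by exact_mod_cast h4
        omega
    exact hall _
  · refine hfact ?_
    have hall : ∀ m, p ∣ (pderiv 0)^[m] (f0 k) ∧ p ∣ (pderiv 0)^[m + 1] (f0 k) := by
      intro m
      induction m with
      | zero => exact ⟨hp0, (hp.dvd_or_dvd hwd).resolve_left hw⟩
      | succ m ih =>
        refine ⟨ih.2, ?_⟩
        have h : p ∣ (X 0 ^ 2 + 4 * X 1) * (pderiv 0)^[m + 2] (f0 k) := by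
          rw [← dvd_add_left (ih.2.mul_left (C (2 * m + 1 - 2 * ((k : ℂ) + 1)) * X 0)),
            ← dvd_add_left (ih.1.mul_left (C (((k : ℂ) + 1 - m) ^ 2))), f0_ode_iterate]
          exact dvd_zero p
        exact (hp.dvd_or_dvd h).resolve_left hw
    exact (hall _).1

lemma weight_one_two (d : Fin 2 →₀ ℕ) :
    Finsupp.weight (![1, 2] : Fin 2 → ℕ) d = d 0 + 2 * d 1 := by
  simp [Finsupp.weight_apply, Finsupp.sum_fintype, mul_comm]

lemma coeff_eq_zero_of_mem_Wt {p : MvPolynomial (Fin 2) ℂ} {n : ℕ} (hp : p ∈ Wt n)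
    {d : Fin 2 →₀ ℕ} (hd : d 0 + 2 * d 1 ≠ n) : coeff d p = 0 :=
  IsWeightedHomogeneous.coeff_eq_zero hp d (by rwa [weight_one_two])

instance (n : ℕ) : FiniteDimensional ℂ (Wt n) :=
  Module.Finite.iff_fg.2 (weightedHomogeneousSubmodule_fg ℂ ![1, 2] (by decide) n)

/-- The exponents of the monomials of weight `n`. -/
noncomputable def weightEquiv (n : ℕ) :
    {d : Fin 2 →₀ ℕ | Finsupp.weight (![1, 2] : Fin 2 → ℕ) d = n} ≃ Fin (n / 2 + 1) where
  toFun d := ⟨d.1 1, by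
    have := d.2
    rw [Set.mem_ofPred_eq, weight_one_two] at this
    omega⟩
  invFun j := ⟨Finsupp.single 0 (n - 2 * j) + Finsupp.single 1 (j : ℕ), by
    rw [Set.mem_ofPred_eq, weight_one_two]
    simp
    omega⟩
  left_inv d := by
    have := d.2
    rw [Set.mem_ofPred_eq, weight_one_two] at this
    ext i
    fin_cases i
    · simp
      omega
    · simp
  right_inv j := by simp

lemma finrank_Wt (n : ℕ) : Module.finrank ℂ (Wt n) = n / 2 + 1 := by
  rw [Wt, weightedHomogeneousSubmodule_eq_finsupp_supported]
  refine (Module.finrank_eq_nat_card_basis (basisRestrictSupport ℂ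
    {d : Fin 2 →₀ ℕ | Finsupp.weight (![1, 2] : Fin 2 → ℕ) d = n})).trans ?_
  rw [Nat.card_congr (weightEquiv n), Nat.card_eq_fintype_card, Fintype.card_fin]

/-- The projection of `ℂ[y,z]` onto its component of weight `n`. -/
noncomputable def comp (n : ℕ) : MvPolynomial (Fin 2) ℂ →ₗ[ℂ] MvPolynomial (Fin 2) ℂ :=
  weightedHomogeneousComponent ![1, 2] n

lemma comp_mem (n : ℕ) (p : MvPolynomial (Fin 2) ℂ) : comp n p ∈ Wt n :=
  weightedHomogeneousComponent_mem _ p n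

lemma comp_same {n : ℕ} {p : MvPolynomial (Fin 2) ℂ} (hp : p ∈ Wt n) : comp n p = p :=
  IsWeightedHomogeneous.weightedHomogeneousComponent_same hp

lemma comp_of_ne {m n : ℕ} {p : MvPolynomial (Fin 2) ℂ} (hp : p ∈ Wt m) (h : n ≠ m) :
    comp n p = 0 :=
  IsWeightedHomogeneous.weightedHomogeneousComponent_ne n hp h

lemma exists_sum_comp (p : MvPolynomial (Fin 2) ℂ) :
    ∃ s : Finset ℕ, p = ∑ n ∈ s, comp n p := by
  refine ⟨(weightedHomogeneousComponent_finsupp (w := (![1, 2] : Fin 2 → ℕ)) p).toFinset, ?_⟩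
  conv_lhs => rw [← sum_weightedHomogeneousComponent (![1, 2] : Fin 2 → ℕ) p]
  exact finsum_eq_sum _ _

lemma comp_mul (n : ℕ) {d : ℕ} (u : MvPolynomial (Fin 2) ℂ) {f : MvPolynomial (Fin 2) ℂ}
    (hf : f ∈ Wt d) : comp n (u * f) = if d ≤ n then comp (n - d) u * f else 0 := by
  let _ := weightedGradedAlgebra ℂ (![1, 2] : Fin 2 → ℕ)
  have h := DirectSum.coe_decompose_mul_of_right_mem
    (weightedHomogeneousSubmodule ℂ (![1, 2] : Fin 2 → ℕ)) n (a := u) hf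
  have h1 : ∀ m (q : MvPolynomial (Fin 2) ℂ), (DirectSum.decompose
      (weightedHomogeneousSubmodule ℂ (![1, 2] : Fin 2 → ℕ)) q m : MvPolynomial (Fin 2) ℂ) =
      comp m q := fun m q => weightedDecomposition.decompose'_apply ℂ _ q m
  rwa [h1, h1] at h

/-- The ideal `J`, as a `ℂ`-submodule of `ℂ[y,z]`. -/
noncomputable def Jsub (k : ℕ) : Submodule ℂ (MvPolynomial (Fin 2) ℂ) :=
  Submodule.restrictScalars ℂ (Jideal k)

lemma mem_Jsub {k : ℕ} {p : MvPolynomial (Fin 2) ℂ} :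
    p ∈ Jsub k ↔ ∃ u v, u * f0 k + v * D2 k (f0 k) = p :=
  Ideal.mem_span_pair

lemma comp_mem_Jsub {k : ℕ} (n : ℕ) {p : MvPolynomial (Fin 2) ℂ} (hp : p ∈ Jsub k) :
    comp n p ∈ Jsub k := by
  obtain ⟨u, v, rfl⟩ := mem_Jsub.1 hp
  rw [map_add, comp_mul n u (f0_mem_Wt k), comp_mul n v (D2_f0_mem_Wt k)]
  refine mem_Jsub.2 ⟨if k + 1 ≤ n then comp (n - (k + 1)) u else 0,
    if k + 2 ≤ n then comp (n - (k + 2)) v else 0, ?_⟩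
  simp only [ite_mul, zero_mul]

lemma Jsub_inf_Wt_of_le {k n : ℕ} (h : n ≤ k) : Jsub k ⊓ Wt n = ⊥ := by
  rw [eq_bot_iff]
  rintro p ⟨hp, hn⟩
  obtain ⟨u, v, rfl⟩ := mem_Jsub.1 hp
  rw [Submodule.mem_bot, ← comp_same hn, map_add, comp_mul n u (f0_mem_Wt k),
    comp_mul n v (D2_f0_mem_Wt k), if_neg (by omega), if_neg (by omega), add_zero]

lemma Wt_zero_eq : Wt 0 = Submodule.span ℂ {1} := by
  refine (Submodule.eq_of_le_of_finrank_eq ?_ ?_).symm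
  · rw [Submodule.span_singleton_le_iff_mem]
    exact C_mem_Wt 1
  · rw [finrank_Wt, finrank_span_singleton one_ne_zero]

lemma Jsub_inf_Wt_succ (k : ℕ) : Jsub k ⊓ Wt (k + 1) = Submodule.span ℂ {f0 k} := by
  refine le_antisymm ?_ ?_
  · rintro p ⟨hp, hn⟩
    obtain ⟨u, v, rfl⟩ := mem_Jsub.1 hp
    rw [← comp_same hn, map_add, comp_mul _ u (f0_mem_Wt k),
      comp_mul _ v (D2_f0_mem_Wt k), if_pos le_rfl, if_neg (by omega), add_zero, Nat.sub_self]
    have h := comp_mem 0 u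
    rw [Wt_zero_eq, Submodule.mem_span_singleton] at h
    obtain ⟨c, hc⟩ := h
    rw [← hc, smul_mul_assoc, one_mul]
    exact Submodule.mem_span_singleton.2 ⟨c, rfl⟩
  · rw [Submodule.span_singleton_le_iff_mem]
    exact ⟨mem_Jsub.2 ⟨1, 0, by simp⟩, f0_mem_Wt k⟩

/-- The map `(u, v) ↦ u f₀ + v f₁` onto the component of `J` of weight `m + k + 2`. -/
noncomputable def syzygyMap (k m : ℕ) : (Wt (m + 1) × Wt m) →ₗ[ℂ] MvPolynomial (Fin 2) ℂ :=
  ((LinearMap.mulRight ℂ (f0 k)).comp (Wt (m + 1)).subtype).coprod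
    ((LinearMap.mulRight ℂ (D2 k (f0 k))).comp (Wt m).subtype)

lemma syzygyMap_apply (k m : ℕ) (x : Wt (m + 1) × Wt m) :
    syzygyMap k m x = x.1 * f0 k + x.2 * D2 k (f0 k) := rfl

lemma range_syzygyMap (k m : ℕ) :
    LinearMap.range (syzygyMap k m) = Jsub k ⊓ Wt (m + (k + 2)) := by
  refine le_antisymm ?_ ?_
  · rintro _ ⟨x, rfl⟩
    rw [syzygyMap_apply]
    exact ⟨mem_Jsub.2 ⟨_, _, rfl⟩, Submodule.add_mem _
      (mul_mem_Wt x.1.2 (f0_mem_Wt k) (by omega)) (mul_mem_Wt x.2.2 (D2_f0_mem_Wt k) rfl)⟩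
  · rintro p ⟨hp, hn⟩
    obtain ⟨u, v, rfl⟩ := mem_Jsub.1 hp
    refine ⟨(⟨comp (m + 1) u, comp_mem _ _⟩, ⟨comp m v, comp_mem _ _⟩), ?_⟩
    rw [syzygyMap_apply, ← comp_same hn, map_add, comp_mul _ u (f0_mem_Wt k),
      comp_mul _ v (D2_f0_mem_Wt k), if_pos (by omega), if_pos (by omega)]
    rw [show m + (k + 2) - (k + 1) = m + 1 by omega, Nat.add_sub_cancel]

lemma eq_zero_of_f0_dvd {k m : ℕ} (hm : m ≤ k) {v : MvPolynomial (Fin 2) ℂ} (hv : v ∈ Wt m)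
    (h : f0 k ∣ v) : v = 0 := by
  obtain ⟨q, rfl⟩ := h
  rw [← comp_same hv, mul_comm, comp_mul m q (f0_mem_Wt k), if_neg (by omega)]

lemma syzygyMap_injective {k m : ℕ} (hk : 0 < k) (hm : m ≤ k) :
    Function.Injective (syzygyMap k m) := by
  rw [injective_iff_map_eq_zero]
  rintro ⟨⟨u, hu⟩, ⟨v, hv⟩⟩ h
  rw [syzygyMap_apply] at h
  have h1 : f0 k ∣ v * D2 k (f0 k) :=
    (dvd_add_right (dvd_mul_left (f0 k) u)).1 (h ▸ dvd_zero _)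
  have h2 : v = 0 := eq_zero_of_f0_dvd hm hv ((isRelPrime_f0_D2_f0 hk).dvd_of_dvd_mul_right h1)
  subst h2
  have h3 : u = 0 := by simpa [f0_ne_zero] using h
  subst h3
  rfl

lemma finrank_Jsub_inf_Wt {k m : ℕ} (hk : 0 < k) (hm : m ≤ k) :
    Module.finrank ℂ (Jsub k ⊓ Wt (m + (k + 2)) : Submodule ℂ (MvPolynomial (Fin 2) ℂ)) =
      m + 2 := by
  rw [← range_syzygyMap, LinearMap.finrank_range_of_inj (syzygyMap_injective hk hm),
    Module.finrank_prod, finrank_Wt, finrank_Wt]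
  omega

lemma mem_of_forall_coeff_ne_zero {V : Submodule ℂ (MvPolynomial (Fin 2) ℂ)}
    {p : MvPolynomial (Fin 2) ℂ}
    (h : ∀ d : Fin 2 →₀ ℕ, coeff d p ≠ 0 → X 0 ^ d 0 * X 1 ^ d 1 ∈ V) : p ∈ V := by
  rw [← support_sum_monomial_coeff p]
  refine Submodule.sum_mem _ fun d hd => ?_
  rw [monomial_eq, Finsupp.prod_fintype _ _ (by simp), Fin.prod_univ_two, ← smul_eq_C_mul]
  exact Submodule.smul_mem _ _ (h d (mem_support_iff.1 hd))

lemma mul_mem_Jsub {k : ℕ} {p : MvPolynomial (Fin 2) ℂ} (q : MvPolynomial (Fin 2) ℂ)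
    (hp : p ∈ Jsub k) : q * p ∈ Jsub k :=
  Ideal.mul_mem_left (Jideal k) q hp

lemma pow_mul_pow_mem_Wt {a b n : ℕ} (h : a + 2 * b = n) :
    (X 0 ^ a * X 1 ^ b : MvPolynomial (Fin 2) ℂ) ∈ Wt n := by
  simpa using C_mul_pow_mem_Wt 1 h

lemma Wt_le_Jsub {k : ℕ} (hk : 0 < k) {n : ℕ} (hn : 2 * k + 1 ≤ n) : Wt n ≤ Jsub k := by
  have base : ∀ m, m ≤ k → (m + (k + 2)) / 2 + 1 = m + 2 → Wt (m + (k + 2)) ≤ Jsub k := by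
    intro m hm h
    refine inf_eq_right.1 (Submodule.eq_of_le_of_finrank_eq inf_le_right ?_)
    rw [finrank_Jsub_inf_Wt hk hm, finrank_Wt, h]
  induction n using Nat.strong_induction_on with
  | _ n ih =>
    by_cases h1 : n ≤ 2 * k + 2
    · obtain ⟨m, rfl⟩ : ∃ m, n = m + (k + 2) := ⟨n - (k + 2), by omega⟩
      exact base m (by omega) (by omega)
    · intro p hp
      refine mem_of_forall_coeff_ne_zero fun d hd => ?_
      have hd : d 0 + 2 * d 1 = n := of_not_not (mt (coeff_eq_zero_of_mem_Wt hp) hd)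
      rcases h : d 1 with _ | b
      · obtain ⟨a, ha⟩ : ∃ a, d 0 = a + 1 := ⟨d 0 - 1, by omega⟩
        rw [ha, pow_succ', mul_assoc]
        exact mul_mem_Jsub _ (ih (n - 1) (by omega) (by omega) (pow_mul_pow_mem_Wt (by omega)))
      · rw [pow_succ', mul_left_comm]
        exact mul_mem_Jsub _ (ih (n - 2) (by omega) (by omega) (pow_mul_pow_mem_Wt (by omega)))

/-- The derivation `y² ∂/∂z + k y ∂/∂y`; the algebra `𝒜` consists of the polynomials that it maps
into `z ℂ[y,z]`. -/
noncomputable def tangentDer (k : ℂ) :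
    Derivation ℂ (MvPolynomial (Fin 2) ℂ) (MvPolynomial (Fin 2) ℂ) :=
  (X 0 ^ 2 : MvPolynomial (Fin 2) ℂ) • pderiv 1 + (C k * X 0 : MvPolynomial (Fin 2) ℂ) • pderiv 0

lemma tangentDer_apply (k : ℂ) (p : MvPolynomial (Fin 2) ℂ) :
    tangentDer k p = X 0 ^ 2 * pderiv 1 p + C k * X 0 * pderiv 0 p := rfl

@[simp]
lemma tangentDer_X_zero (k : ℂ) : tangentDer k (X 0) = C k * X 0 := by
  simp [tangentDer_apply, pderiv_X]

@[simp]
lemma tangentDer_X_one (k : ℂ) : tangentDer k (X 1) = X 0 ^ 2 := by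
  simp [tangentDer_apply, pderiv_X]

@[simp]
lemma tangentDer_C (k c : ℂ) : tangentDer k (C c) = 0 := by
  simp

/-- The coefficient of `y ^ n` in the image of a polynomial under `tangentDer k`. -/
noncomputable def tangentCoeff (k : ℂ) (n : ℕ) : MvPolynomial (Fin 2) ℂ →ₗ[ℂ] ℂ :=
  (lcoeff ℂ (Finsupp.single 0 n)).comp (tangentDer k).toLinearMap

lemma tangentCoeff_apply (k : ℂ) (n : ℕ) (p : MvPolynomial (Fin 2) ℂ) :
    tangentCoeff k n p = coeff (Finsupp.single 0 n) (tangentDer k p) := rfl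

lemma coeff_single_of_X_dvd {p : MvPolynomial (Fin 2) ℂ} (h : X 1 ∣ p) (n : ℕ) :
    coeff (Finsupp.single 0 n) p = 0 := by
  obtain ⟨q, rfl⟩ := h
  rw [coeff_X_mul', if_neg]
  simp

lemma tangentCoeff_eq (k : ℂ) (n : ℕ) (p : MvPolynomial (Fin 2) ℂ) :
    tangentCoeff k n p =
      (if 2 ≤ n then coeff (Finsupp.single 0 (n - 2) + Finsupp.single 1 1) p else 0)
        + k * n * coeff (Finsupp.single 0 n) p := by
  rw [tangentCoeff_apply, tangentDer_apply, coeff_add, mul_assoc, coeff_C_mul, X_pow_eq_monomial,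
    coeff_monomial_mul', coeff_X_mul', coeff_pderiv, coeff_pderiv, ← Finsupp.single_tsub,
    ← Finsupp.single_tsub]
  congr 1
  · simp
  · rcases n with _ | n
    · simp
    · rw [if_pos (by simp), Nat.add_sub_cancel, ← Finsupp.single_add]
      simp
      ring

lemma g2_mem (k : ℂ) : g2 k ∈ calA k := Algebra.subset_adjoin (by simp)
lemma g3_mem (k : ℂ) : g3 k ∈ calA k := Algebra.subset_adjoin (by simp)
lemma g4_mem (k : ℂ) : g4 ∈ calA k := Algebra.subset_adjoin (by simp)
lemma g5_mem (k : ℂ) : g5 ∈ calA k := Algebra.subset_adjoin (by simp)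

lemma mul_mem_calA {k : ℂ} {p q : MvPolynomial (Fin 2) ℂ} (hp : p ∈ calA k) (hq : q ∈ calA k) :
    p * q ∈ calA k := Subalgebra.mul_mem _ hp hq

lemma C_mem_calA (k c : ℂ) : C c ∈ calA k := Subalgebra.algebraMap_mem _ c

lemma X_dvd_tangentDer {k : ℂ} {p : MvPolynomial (Fin 2) ℂ} (hp : p ∈ calA k) :
    X 1 ∣ tangentDer k p := by
  refine Algebra.adjoin_induction (fun x hx => ?_) (fun c => ?_) (fun x y _ _ hx hy => ?_)
    (fun x y _ _ hx hy => ?_) hp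
  · have hC2 : C (σ := Fin 2) (2 : ℂ) = 2 := map_ofNat C 2
    have hC3 : C (σ := Fin 2) (3 : ℂ) = 3 := map_ofNat C 3
    rcases hx with rfl | rfl | rfl | rfl
    · refine ⟨0, ?_⟩
      simp [g2]
      simp [hC2]
      ring
    · refine ⟨-3 * C k ^ 2 * X 0, ?_⟩
      simp [g3]
      simp [hC3]
      ring
    · exact ⟨2 * X 0 ^ 2, by simp [g4]; ring⟩
    · exact ⟨2 * X 0 ^ 3 + C k * X 0 * X 1, by simp [g5]; ring⟩
  · rw [Derivation.map_algebraMap]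
    exact dvd_zero _
  · rw [map_add]
    exact dvd_add hx hy
  · rw [Derivation.leibniz]
    exact dvd_add (hy.mul_left x) (hx.mul_left y)

lemma tangentCoeff_of_mem {k : ℂ} {p : MvPolynomial (Fin 2) ℂ} (hp : p ∈ calA k) (n : ℕ) :
    tangentCoeff k n p = 0 :=
  coeff_single_of_X_dvd (X_dvd_tangentDer hp) n

lemma X_one_pow_mem_calA {k : ℂ} (hk : k ≠ 0) (b : ℕ) : X 1 ^ (b + 2) ∈ calA k := by
  induction b using Nat.strong_induction_on with
  | _ b ih =>
    rcases b with _ | _ | b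
    · exact g4_mem k
    · have hC2 : C (σ := Fin 2) (2 : ℂ) = 2 := map_ofNat C 2
      have hC3 : C (σ := Fin 2) (3 : ℂ) = 3 := map_ofNat C 3
      have h : (X 1 ^ 3 : MvPolynomial (Fin 2) ℂ) =
          C ((2 * k ^ 3)⁻¹) * (g3 k * g3 k - g2 k * g2 k * g2 k + C (3 * k ^ 2) * (g2 k * g4)) := by
        have h1 : C (σ := Fin 2) ((2 * k ^ 3)⁻¹) * (2 * C k ^ 3) = 1 := by
          rw [← hC2, ← map_pow, ← map_mul, ← map_mul, inv_mul_cancel₀ (by simpa using hk), map_one]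
        simp only [g2, g3, g4, map_mul, map_pow, hC2, hC3] at h1 ⊢
        linear_combination -X 1 ^ 3 * h1
      rw [zero_add, show 1 + 2 = 3 by rfl, h]
      exact mul_mem_calA (C_mem_calA _ _) (Submodule.add_mem _ (Submodule.sub_mem _
        (mul_mem_calA (g3_mem k) (g3_mem k))
        (mul_mem_calA (mul_mem_calA (g2_mem k) (g2_mem k)) (g2_mem k)))
        (mul_mem_calA (C_mem_calA _ _) (mul_mem_calA (g2_mem k) (g4_mem k))))
    · rw [show b + 1 + 1 + 2 = 2 + (b + 2) by omega, pow_add]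
      exact mul_mem_calA (g4_mem k) (ih b (by omega))

lemma pow_mul_pow_mem_calA {k : ℂ} (hk : k ≠ 0) (a b : ℕ) :
    X 0 ^ a * X 1 ^ (b + 2) ∈ calA k := by
  have hone : ∀ b, X 0 * X 1 ^ (b + 2) ∈ calA k := by
    intro b
    rcases b with _ | _ | b
    · exact g5_mem k
    · have h : (X 0 * X 1 ^ 3 : MvPolynomial (Fin 2) ℂ) =
          C k⁻¹ * (g2 k * g5 - g3 k * g4) := by
        have hC2 : C (σ := Fin 2) (2 : ℂ) = 2 := map_ofNat C 2
        have hC3 : C (σ := Fin 2) (3 : ℂ) = 3 := map_ofNat C 3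
        have h1 : C (σ := Fin 2) k⁻¹ * C k = 1 := by
          rw [← map_mul, inv_mul_cancel₀ hk, map_one]
        simp only [g2, g3, g4, g5, map_mul, hC2, hC3]
        linear_combination -X 0 * X 1 ^ 3 * h1
      rw [zero_add, show 1 + 2 = 3 by rfl, h]
      exact mul_mem_calA (C_mem_calA _ _) (Submodule.sub_mem _
        (mul_mem_calA (g2_mem k) (g5_mem k)) (mul_mem_calA (g3_mem k) (g4_mem k)))
    · rw [show b + 1 + 1 + 2 = 2 + (b + 2) by omega, pow_add, ← mul_assoc]
      exact mul_mem_calA (g5_mem k) (X_one_pow_mem_calA hk b)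
  induction a using Nat.strong_induction_on generalizing b with
  | _ a ih =>
    rcases a with _ | _ | a
    · simpa using X_one_pow_mem_calA hk b
    · simpa using hone b
    · have h : (X 0 ^ (a + 1 + 1) * X 1 ^ (b + 2) : MvPolynomial (Fin 2) ℂ) =
          g2 k * (X 0 ^ a * X 1 ^ (b + 2)) + C (2 * k) * (X 0 ^ a * X 1 ^ (b + 1 + 2)) := by
        rw [g2]
        ring
      rw [h]
      exact Submodule.add_mem _ (mul_mem_calA (g2_mem k) (ih a (by omega) b))
        (mul_mem_calA (C_mem_calA _ _) (ih a (by omega) (b + 1)))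

lemma g2_mem_Wt (k : ℂ) : g2 k ∈ Wt 2 :=
  Submodule.sub_mem _ (IsWeightedHomogeneous.pow X_zero_mem_Wt 2)
    (mul_mem_Wt (C_mem_Wt _) X_one_mem_Wt rfl)

lemma g3_mem_Wt (k : ℂ) : g3 k ∈ Wt 3 :=
  Submodule.sub_mem _ (IsWeightedHomogeneous.pow X_zero_mem_Wt 3)
    (mul_mem_Wt (mul_mem_Wt (C_mem_Wt _) X_zero_mem_Wt rfl) X_one_mem_Wt rfl)

lemma exists_mem_calA_X_dvd_sub_pow (k : ℂ) {n : ℕ} (hn : n ≠ 1) :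
    ∃ g ∈ calA k, g ∈ Wt n ∧ X 1 ∣ g - X 0 ^ n := by
  induction n using Nat.strong_induction_on with
  | _ n ih =>
    rcases n with _ | _ | _ | _ | n
    · exact ⟨1, by simpa using C_mem_calA k 1, by simpa using C_mem_Wt 1, by simp⟩
    · exact absurd rfl hn
    · exact ⟨g2 k, g2_mem k, g2_mem_Wt k, -C (2 * k), by rw [g2]; ring⟩
    · exact ⟨g3 k, g3_mem k, g3_mem_Wt k, -C (3 * k) * X 0, by rw [g3]; ring⟩
    · obtain ⟨g, hg, hgn, q, hq⟩ := ih (n + 2) (by omega) (by omega)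
      refine ⟨g2 k * g, mul_mem_calA (g2_mem k) hg, mul_mem_Wt (g2_mem_Wt k) hgn (by omega),
        X 0 ^ 2 * q - C (2 * k) * g, ?_⟩
      rw [g2]
      linear_combination X 0 ^ 2 * hq

lemma mem_calA_of_tangentCoeff {k : ℂ} (hk : k ≠ 0) {n : ℕ} {p : MvPolynomial (Fin 2) ℂ}
    (hp : p ∈ Wt n) (h : tangentCoeff k n p = 0) : p ∈ calA k := by
  obtain ⟨g, hg, hgn, hgc⟩ : ∃ g ∈ calA k, g ∈ Wt n ∧
      coeff (Finsupp.single 0 n) g = coeff (Finsupp.single 0 n) p := by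
    by_cases hn : n = 1
    · subst hn
      refine ⟨0, Submodule.zero_mem _, Submodule.zero_mem _, ?_⟩
      rw [tangentCoeff_eq, if_neg (by omega)] at h
      simpa [hk, eq_comm] using h
    · obtain ⟨g, hg, hgn, hgc⟩ := exists_mem_calA_X_dvd_sub_pow k hn
      refine ⟨coeff (Finsupp.single 0 n) p • g, Submodule.smul_mem _ _ hg,
        Submodule.smul_mem _ _ hgn, ?_⟩
      have h1 := coeff_single_of_X_dvd hgc n
      rw [coeff_sub, X_pow_eq_monomial, coeff_monomial, if_pos rfl, sub_eq_zero] at h1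
      rw [coeff_smul, h1, smul_eq_mul, mul_one]
  have hq : p - g ∈ Wt n := Submodule.sub_mem _ hp hgn
  have hq0 : coeff (Finsupp.single 0 n) (p - g) = 0 := by rw [coeff_sub, hgc, sub_self]
  have hq1 : tangentCoeff k n (p - g) = 0 := by
    rw [map_sub, h, tangentCoeff_of_mem hg, sub_zero]
  rw [tangentCoeff_eq, hq0, mul_zero, add_zero] at hq1
  rw [← sub_add_cancel p g]
  refine Submodule.add_mem _ (mem_of_forall_coeff_ne_zero fun d hd => ?_) hg
  have hdn : d 0 + 2 * d 1 = n := of_not_not (mt (coeff_eq_zero_of_mem_Wt hq) hd)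
  rcases hd1 : d 1 with _ | _ | b
  · refine absurd ?_ hd
    rwa [show d = Finsupp.single 0 n by ext i; fin_cases i <;> simp <;> omega]
  · refine absurd ?_ hd
    rw [if_pos (by omega)] at hq1
    rwa [show d = Finsupp.single 0 (n - 2) + Finsupp.single 1 1 by
      ext i; fin_cases i <;> simp <;> omega]
  · exact pow_mul_pow_mem_calA hk _ _

lemma calA_inf_Wt {k : ℂ} (hk : k ≠ 0) (n : ℕ) :
    calA k ⊓ Wt n = Wt n ⊓ LinearMap.ker (tangentCoeff k n) := by
  ext p
  exact ⟨fun h => ⟨h.2, tangentCoeff_of_mem h.1 n⟩,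
    fun h => ⟨mem_calA_of_tangentCoeff hk h.1 h.2, h.1⟩⟩

lemma tangentCoeff_comp (k : ℂ) (n : ℕ) (p : MvPolynomial (Fin 2) ℂ) :
    tangentCoeff k n (comp n p) = tangentCoeff k n p := by
  have h1 (d : Fin 2 →₀ ℕ) (hd : d 0 + 2 * d 1 = n) : coeff d (comp n p) = coeff d p := by
    rw [comp, coeff_weightedHomogeneousComponent, weight_one_two, if_pos hd]
  rw [tangentCoeff_eq, tangentCoeff_eq, h1 (Finsupp.single 0 n) (by simp)]
  split_ifs with h2
  · rw [h1 _ (by simp [Nat.sub_add_cancel h2])]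
  · rfl

lemma comp_mem_calA {k : ℂ} (hk : k ≠ 0) (n : ℕ) {p : MvPolynomial (Fin 2) ℂ} (hp : p ∈ calA k) :
    comp n p ∈ calA k :=
  mem_calA_of_tangentCoeff hk (comp_mem n p)
    ((tangentCoeff_comp k n p).trans (tangentCoeff_of_mem hp n))

lemma exists_f0_eq {k : ℕ} (hk : 0 < k) : ∃ q : MvPolynomial (Fin 2) ℂ,
    f0 k = X 0 ^ (k + 1) - C ((k : ℂ) * (k + 1)) * X 0 ^ (k - 1) * X 1 + X 1 ^ 2 * q := by
  obtain ⟨m, hm⟩ : ∃ m, (k + 1) / 2 = m + 1 := ⟨(k + 1) / 2 - 1, by omega⟩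
  have h1 : f0Coeff (k + 1) 1 = -((k : ℂ) * (k + 1)) := by
    have h := f0Coeff_succ (k + 1) 0
    simp [f0Coeff_zero] at h
    linear_combination h
  refine ⟨∑ j ∈ Finset.range m, C (f0Coeff (k + 1) (j + 1 + 1)) *
    X 0 ^ (k + 1 - 2 * (j + 1 + 1)) * X 1 ^ j, ?_⟩
  rw [f0_eq, hm, Finset.sum_range_succ', Finset.sum_range_succ', zero_add, h1, f0Coeff_zero,
    Finset.mul_sum, map_neg]
  have h2 : ∀ j ∈ Finset.range m, C (f0Coeff (k + 1) (j + 1 + 1)) *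
      X 0 ^ (k + 1 - 2 * (j + 1 + 1)) * X 1 ^ (j + 1 + 1) = X 1 ^ 2 *
      (C (f0Coeff (k + 1) (j + 1 + 1)) * X 0 ^ (k + 1 - 2 * (j + 1 + 1)) * X 1 ^ j :
        MvPolynomial (Fin 2) ℂ) := fun j _ => by ring
  rw [Finset.sum_congr rfl h2, show k + 1 - 2 * 1 = k - 1 by omega, Nat.mul_zero, Nat.sub_zero,
    map_one]
  ring

lemma X_dvd_tangentDer_f0 {k : ℕ} (hk : 0 < k) : X 1 ∣ tangentDer k (f0 k) := by
  obtain ⟨q, hq⟩ := exists_f0_eq hk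
  obtain ⟨m, rfl⟩ : ∃ m, k = m + 1 := ⟨k - 1, by omega⟩
  refine ⟨2 * X 0 ^ 2 * q + X 1 * tangentDer (m + 1 : ℕ) q
    - C (((m + 1 : ℕ) : ℂ) * ((m + 1 : ℕ) + 1)) * C ((m + 1 : ℕ) : ℂ) * C (m : ℂ) * X 0 ^ m, ?_⟩
  rw [hq, Nat.add_sub_cancel]
  simp only [map_add, map_sub, Derivation.leibniz, Derivation.leibniz_pow, tangentDer_X_zero,
    tangentDer_X_one, tangentDer_C, smul_eq_mul]
  simp
  rcases m with _ | m
  · simp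
    ring
  · simp
    ring

lemma f0_mem_calA {k : ℕ} (hk : 0 < k) : f0 k ∈ calA (k : ℂ) :=
  mem_calA_of_tangentCoeff (by exact_mod_cast hk.ne') (f0_mem_Wt k)
    (coeff_single_of_X_dvd (X_dvd_tangentDer_f0 hk) _)

lemma tangentCoeff_X_pow_mul_f0 {k : ℕ} (hk : 0 < k) (m : ℕ) :
    tangentCoeff k (m + (k + 1)) (X 0 ^ m * f0 k) = k * m := by
  obtain ⟨q, hq⟩ := exists_f0_eq hk
  obtain ⟨r, hr⟩ := X_dvd_tangentDer_f0 hk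
  have h : X 1 ∣ tangentDer k (X 0 ^ m * f0 k) - C ((k : ℂ) * m) * X 0 ^ (m + (k + 1)) := by
    refine ⟨X 0 ^ m * r + C ((k : ℂ) * m) * X 0 ^ m *
      (X 1 * q - C ((k : ℂ) * (k + 1)) * X 0 ^ (k - 1)), ?_⟩
    rw [Derivation.leibniz, hr, Derivation.leibniz_pow, tangentDer_X_zero, hq]
    rcases m with _ | m
    · simp
    · simp
      ring
  have h1 := coeff_single_of_X_dvd h (m + (k + 1))
  rw [coeff_sub, coeff_C_mul, X_pow_eq_monomial (e := m + (k + 1)), coeff_monomial, if_pos rfl,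
    sub_eq_zero, mul_one] at h1
  exact h1

lemma finrank_inf_ker_add_one {V : Type*} [AddCommGroup V] [Module ℂ V] {W : Submodule ℂ V}
    [FiniteDimensional ℂ W] {φ : V →ₗ[ℂ] ℂ} {v : V} (hv : v ∈ W) (hφ : φ v ≠ 0) :
    Module.finrank ℂ (W ⊓ LinearMap.ker φ : Submodule ℂ V) + 1 = Module.finrank ℂ W := by
  have h0 : φ.domRestrict W ≠ 0 := fun h => hφ (LinearMap.congr_fun h ⟨v, hv⟩)
  have h1 := LinearMap.finrank_range_add_finrank_ker (φ.domRestrict W)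
  rw [Module.Dual.range_eq_top_of_ne_zero h0, finrank_top, Module.finrank_self,
    LinearMap.ker_domRestrict, ← Submodule.finrank_map_subtype_eq,
    Submodule.map_comap_subtype] at h1
  omega

lemma finrank_calA_inf_Wt {k : ℂ} (hk : k ≠ 0) (n : ℕ) :
    Module.finrank ℂ (calA k ⊓ Wt n : Submodule ℂ (MvPolynomial (Fin 2) ℂ)) =
      n / 2 + if n = 0 then 1 else 0 := by
  rw [calA_inf_Wt hk]
  split_ifs with hn
  · subst hn
    have h : LinearMap.ker (tangentCoeff k 0) = ⊤ := by
      rw [LinearMap.ker_eq_top]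
      ext p
      simp [tangentCoeff_eq]
    rw [h, inf_top_eq, finrank_Wt]
  · have hX : (X 0 ^ n : MvPolynomial (Fin 2) ℂ) ∈ Wt n := by
      simpa using pow_mul_pow_mem_Wt (show n + 2 * 0 = n by omega)
    have hc : tangentCoeff k n (X 0 ^ n) ≠ 0 := by
      have h : (Finsupp.single 0 n : Fin 2 →₀ ℕ) ≠ Finsupp.single 0 (n - 2) + Finsupp.single 1 1 :=
        fun h => by simpa using DFunLike.congr_fun h 1
      rw [tangentCoeff_eq, X_pow_eq_monomial, coeff_monomial, coeff_monomial, if_pos rfl,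
        if_neg h, ite_self, zero_add, mul_one]
      exact mul_ne_zero hk (by exact_mod_cast hn)
    have := finrank_inf_ker_add_one hX hc
    rw [finrank_Wt] at this
    omega

lemma JA_inf_Wt {k : ℕ} (hk : 0 < k) (n : ℕ) :
    JA k ⊓ Wt n = (Jsub k ⊓ Wt n) ⊓ LinearMap.ker (tangentCoeff k n) := by
  change Jsub k ⊓ calA k ⊓ Wt n = _
  rw [inf_assoc, calA_inf_Wt (by exact_mod_cast hk.ne'), inf_assoc]

lemma JA_inf_Wt_of_le {k n : ℕ} (hk : 0 < k) (hn : n ≤ k) : JA k ⊓ Wt n = ⊥ := by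
  rw [JA_inf_Wt hk, Jsub_inf_Wt_of_le hn, bot_inf_eq]

lemma JA_inf_Wt_succ {k : ℕ} (hk : 0 < k) :
    JA k ⊓ Wt (k + 1) = Submodule.span ℂ {f0 k} := by
  rw [JA_inf_Wt hk, Jsub_inf_Wt_succ, inf_eq_left, Submodule.span_singleton_le_iff_mem]
  exact tangentCoeff_of_mem (f0_mem_calA hk) _

lemma finrank_JA_inf_Wt {k n : ℕ} (hk : 0 < k) (h1 : k + 2 ≤ n) (h2 : n ≤ 2 * k + 2) :
    Module.finrank ℂ (JA k ⊓ Wt n : Submodule ℂ (MvPolynomial (Fin 2) ℂ)) = n - k - 1 := by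
  obtain ⟨m, rfl⟩ : ∃ m, n = m + (k + 2) := ⟨n - (k + 2), by omega⟩
  rw [JA_inf_Wt hk]
  have hv : X 0 ^ (m + 1) * f0 k ∈ Jsub k ⊓ Wt (m + (k + 2)) :=
    ⟨mem_Jsub.2 ⟨X 0 ^ (m + 1), 0, by simp⟩,
      mul_mem_Wt (m := m + 1)
        (by simpa using pow_mul_pow_mem_Wt (show m + 1 + 2 * 0 = m + 1 by omega))
        (f0_mem_Wt k) (by omega)⟩
  have hφ : tangentCoeff k (m + (k + 2)) (X 0 ^ (m + 1) * f0 k) ≠ 0 := by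
    rw [show m + (k + 2) = m + 1 + (k + 1) by omega, tangentCoeff_X_pow_mul_f0 hk]
    exact mul_ne_zero (by exact_mod_cast hk.ne') (by exact_mod_cast m.succ_ne_zero)
  have : FiniteDimensional ℂ (Jsub k ⊓ Wt (m + (k + 2)) : Submodule ℂ (MvPolynomial (Fin 2) ℂ)) :=
    Submodule.finiteDimensional_inf_right _ _
  have := finrank_inf_ker_add_one hv hφ
  rw [finrank_Jsub_inf_Wt hk (by omega)] at this
  omega

lemma JA_inf_Wt_of_ge {k n : ℕ} (hk : 0 < k) (hn : 2 * k + 1 ≤ n) :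
    JA k ⊓ Wt n = calA k ⊓ Wt n := by
  rw [JA_inf_Wt hk, inf_eq_right.2 (Wt_le_Jsub hk hn), calA_inf_Wt (by exact_mod_cast hk.ne')]

lemma finrank_quotient_iInf_comap {ι V : Type*} {W : ι → Type*} [Fintype ι] [AddCommGroup V]
    [Module ℂ V] [∀ i, AddCommGroup (W i)] [∀ i, Module ℂ (W i)] [∀ i, FiniteDimensional ℂ (W i)]
    (f : ∀ i, V →ₗ[ℂ] W i) (U : ∀ i, Submodule ℂ (W i))
    (hf : ∀ x : ∀ i, W i, ∃ v, ∀ i, f i v = x i) :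
    Module.finrank ℂ (V ⧸ ⨅ i, (U i).comap (f i)) =
      ∑ i, (Module.finrank ℂ (W i) - Module.finrank ℂ (U i)) := by
  let F : V →ₗ[ℂ] ∀ i, W i ⧸ U i := LinearMap.pi fun i => (U i).mkQ.comp (f i)
  have hker : LinearMap.ker F = ⨅ i, (U i).comap (f i) := by
    simp [F, LinearMap.ker_pi, LinearMap.ker_comp]
  have hsurj : Function.Surjective F := by
    intro x
    choose y hy using fun i => (U i).mkQ_surjective (x i)
    obtain ⟨v, hv⟩ := hf y
    refine ⟨v, funext fun i => ?_⟩
    rw [← hy i, ← hv i]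
    rfl
  rw [← hker, (F.quotKerEquivOfSurjective hsurj).finrank_eq, Module.finrank_pi_fintype]
  exact Finset.sum_congr rfl fun i _ => (U i).finrank_quotient

/-- A graded quotient that vanishes in weights at least `N` has dimension the sum of the dimensions
of its components of weight less than `N`. -/
lemma finrank_quotient_eq_sum {A B : Submodule ℂ (MvPolynomial (Fin 2) ℂ)} {N : ℕ}
    (hA : ∀ n, ∀ p ∈ A, comp n p ∈ A) (hB : ∀ n, ∀ p ∈ B, comp n p ∈ B)
    (hN : ∀ n, N ≤ n → A ⊓ Wt n ≤ B) :
    Module.finrank ℂ (A ⧸ Submodule.comap A.subtype B) = ∑ n ∈ Finset.range N,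
      (Module.finrank ℂ (A ⊓ Wt n : Submodule ℂ (MvPolynomial (Fin 2) ℂ)) -
        Module.finrank ℂ (B ⊓ A ⊓ Wt n : Submodule ℂ (MvPolynomial (Fin 2) ℂ))) := by
  have hfin : ∀ n, FiniteDimensional ℂ (A ⊓ Wt n : Submodule ℂ (MvPolynomial (Fin 2) ℂ)) :=
    fun n => Submodule.finiteDimensional_inf_right _ _
  let π : (n : ℕ) → A →ₗ[ℂ] (A ⊓ Wt n : Submodule ℂ (MvPolynomial (Fin 2) ℂ)) := fun n =>
    ((comp n).comp A.subtype).codRestrict _ fun p => ⟨hA n p p.2, comp_mem n p⟩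
  have hB' : Submodule.comap A.subtype B =
      ⨅ n : Fin N, (Submodule.comap (A ⊓ Wt n).subtype B).comap (π n) := by
    ext p
    rw [Submodule.mem_iInf]
    refine ⟨fun h n => hB n p h, fun h => ?_⟩
    obtain ⟨s, hs⟩ := exists_sum_comp (p : MvPolynomial (Fin 2) ℂ)
    change (p : MvPolynomial (Fin 2) ℂ) ∈ B
    rw [hs]
    refine Submodule.sum_mem _ fun n _ => ?_
    by_cases hn : n < N
    · exact h ⟨n, hn⟩
    · exact hN n (not_lt.1 hn) ⟨hA n p p.2, comp_mem n p⟩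
  rw [hB', finrank_quotient_iInf_comap, ← Fin.sum_univ_eq_sum_range fun n =>
      Module.finrank ℂ (A ⊓ Wt n : Submodule ℂ (MvPolynomial (Fin 2) ℂ)) -
        Module.finrank ℂ (B ⊓ A ⊓ Wt n : Submodule ℂ (MvPolynomial (Fin 2) ℂ))]
  · refine Finset.sum_congr rfl fun n _ => ?_
    rw [← Submodule.finrank_map_subtype_eq, Submodule.map_comap_subtype,
      inf_comm (A ⊓ Wt n) B, ← inf_assoc]
  · intro y
    refine ⟨⟨∑ n, (y n : MvPolynomial (Fin 2) ℂ), Submodule.sum_mem _ fun n _ => (y n).2.1⟩,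
      fun m => Subtype.ext ?_⟩
    change comp m (∑ n, (y n : MvPolynomial (Fin 2) ℂ)) = y m
    rw [map_sum, Finset.sum_eq_single m]
    · exact comp_same (y m).2.2
    · intro n _ hn
      exact comp_of_ne (y n).2.2 fun h => hn (Fin.ext h.symm)
    · simp

lemma sum_range_div_two (k : ℕ) : ∑ n ∈ Finset.range (2 * k + 1), n / 2 = k * k := by
  induction k with
  | zero => rfl
  | succ k ih =>
    rw [show 2 * (k + 1) + 1 = 2 * k + 1 + 1 + 1 by omega, Finset.sum_range_succ,
      Finset.sum_range_succ, ih, show (2 * k + 1) / 2 = k by omega,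
      show (2 * k + 1 + 1) / 2 = k + 1 by omega]
    ring

lemma finrank_calA_quotient {k : ℕ} (hk : 0 < k) :
    Module.finrank ℂ (calA (k : ℂ) ⧸ Submodule.comap (calA (k : ℂ)).subtype (Jsub k)) =
      k * (k + 1) / 2 := by
  have hk0 : (k : ℂ) ≠ 0 := by exact_mod_cast hk.ne'
  rw [finrank_quotient_eq_sum (N := 2 * k + 1) (fun n p hp => comp_mem_calA hk0 n hp)
    (fun n p hp => comp_mem_Jsub n hp) (fun n hn => inf_le_right.trans (Wt_le_Jsub hk hn))]
  have hJ : ∀ n < 2 * k + 1,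
      Module.finrank ℂ (Jsub k ⊓ calA k ⊓ Wt n : Submodule ℂ (MvPolynomial (Fin 2) ℂ)) =
        (n - (k + 1)) + if n = k + 1 then 1 else 0 := by
    intro n hn
    change Module.finrank ℂ (JA k ⊓ Wt n : Submodule ℂ (MvPolynomial (Fin 2) ℂ)) = _
    rcases lt_trichotomy n (k + 1) with h | h | h
    · rw [JA_inf_Wt_of_le hk (by omega), finrank_bot, if_neg (by omega)]
      omega
    · rw [h, JA_inf_Wt_succ hk, finrank_span_singleton (f0_ne_zero k), if_pos rfl]
      omega
    · rw [finrank_JA_inf_Wt hk (by omega) (by omega), if_neg (by omega)]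
      omega
  have hsum : ∑ n ∈ Finset.range (2 * k + 1), (n - (k + 1)) = ∑ n ∈ Finset.range k, n := by
    rw [show 2 * k + 1 = k + 1 + k by omega, Finset.sum_range_add,
      Finset.sum_eq_zero fun n hn => by have := Finset.mem_range.1 hn; omega, zero_add]
    exact Finset.sum_congr rfl fun n _ => by omega
  have hB : ∑ n ∈ Finset.range (2 * k + 1), ((n - (k + 1)) + if n = k + 1 then 1 else 0) =
      ∑ n ∈ Finset.range k, n + 1 := by
    rw [Finset.sum_add_distrib, hsum, Finset.sum_ite_eq', if_pos (Finset.mem_range.2 (by omega))]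
  have hA : ∑ n ∈ Finset.range (2 * k + 1), (n / 2 + if n = 0 then 1 else 0) = k * k + 1 := by
    rw [Finset.sum_add_distrib, sum_range_div_two, Finset.sum_ite_eq', if_pos (by simp)]
  have hs := Finset.sum_range_id_mul_two k
  rw [Finset.sum_congr rfl fun n hn => by
    rw [hJ n (Finset.mem_range.1 hn), finrank_calA_inf_Wt hk0]]
  have hle : ∀ n ∈ Finset.range (2 * k + 1), (n - (k + 1)) + (if n = k + 1 then 1 else 0) ≤
      n / 2 + if n = 0 then 1 else 0 := by
    intro n hn
    have := Finset.mem_range.1 hn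
    split_ifs <;> omega
  rw [Finset.sum_tsub_distrib _ hle, hA, hB]
  obtain ⟨m, rfl⟩ : ∃ m, k = m + 1 := ⟨k - 1, by omega⟩
  rw [Nat.add_sub_cancel] at hs
  have h1 : (m + 1) * (m + 1) = m * m + 2 * m + 1 := by ring
  have h2 : (m + 1) * (m + 1 + 1) = m * m + 3 * m + 2 := by ring
  have h3 : (m + 1) * m = m * m + m := by ring
  omega

theorem stmt_18 (k : ℕ) (hk : 5 ≤ k) :
    Module.finrank ℂ
      ((calA (k : ℂ)) ⧸
        (Submodule.comap (calA (k : ℂ)).subtype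
          (Submodule.restrictScalars ℂ (Jideal k)))) = k * (k + 1) / 2 ∧
    (∀ n : ℕ, n ≤ k → JA k ⊓ Wt n = ⊥) ∧
    JA k ⊓ Wt (k + 1) = Submodule.span ℂ {f0 k} ∧
    (∀ n : ℕ, k + 2 ≤ n → n ≤ 2 * k + 2 →
      Module.finrank ℂ (JA k ⊓ Wt n : Submodule ℂ (MvPolynomial (Fin 2) ℂ)) = n - k - 1) ∧
    (∀ n : ℕ, 2 * k + 1 ≤ n → JA k ⊓ Wt n = calA (k : ℂ) ⊓ Wt n) := by
  have hk0 : 0 < k := by omega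
  exact ⟨finrank_calA_quotient hk0, fun n hn => JA_inf_Wt_of_le hk0 hn, JA_inf_Wt_succ hk0,
    fun n h1 h2 => finrank_JA_inf_Wt hk0 h1 h2, fun n hn => JA_inf_Wt_of_ge hk0 hn⟩
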